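/- Let α, σ > 0, let V ∈ ℝ^{n×r}, let Π₊(V) denote the entrywise positive part of V (i.e., Π₊(V)_{ij} = max(V_{ij}, 0)), and let τ ∈ ℝ with τ ≥ σ satisfy τ²(τ − σ) = α‖Π₊(V)‖². Then W* = (1/τ)·Π₊(V) is the unique minimizer of W ↦ h_u(W) − ⟨V, W⟩ over the nonnegative orthant {W ∈ ℝ^{n×r} : W_{ij} ≥ 0 for all i, j}, where h_u(W) = (α/4)‖W‖⁴ + (σ/2)‖W‖². Consequently, when g is the indicator of the nonnegative orthant, the Bregman iteration map of h_u is T_λ(X) = Π₊(U) / τ_σ(α‖Π₊(U)‖²) with U = ∇h_u(X) − λ∇f(X). -/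

import Mathlib

open Matrix

attribute [local instance] Matrix.frobeniusNormedAddCommGroup Matrix.frobeniusNormedSpace

/-- Frobenius inner product `⟨X, Y⟩ = Tr(Xᵀ Y)`. -/
noncomputable def minner {n r : ℕ} (X Y : Matrix (Fin n) (Fin r) ℝ) : ℝ := (Xᵀ * Y).trace

/-- The universal kernel `h_u(X) = (α/4)‖X‖⁴ + (σ/2)‖X‖²` (Frobenius norm). -/
noncomputable def hu {n r : ℕ} (α σ : ℝ) (X : Matrix (Fin n) (Fin r) ℝ) : ℝ :=
  α / 4 * ‖X‖ ^ 4 + σ / 2 * ‖X‖ ^ 2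

/-- Entrywise positive part `Π₊(V)ᵢⱼ = max(Vᵢⱼ, 0)`. -/
def posPart {n r : ℕ} (V : Matrix (Fin n) (Fin r) ℝ) : Matrix (Fin n) (Fin r) ℝ :=
  fun i j => max (V i j) 0

lemma minner_eq {n r : ℕ} (X Y : Matrix (Fin n) (Fin r) ℝ) :
    minner X Y = ∑ j, ∑ i, X i j * Y i j := by
  simp [minner, Matrix.trace, Matrix.mul_apply]

lemma minner_self {n r : ℕ} (X : Matrix (Fin n) (Fin r) ℝ) : ‖X‖ ^ 2 = minner X X := by
  rw [minner_eq, Matrix.frobenius_norm_def, ← Real.sqrt_eq_rpow, Real.sq_sqrt (by positivity),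
    Finset.sum_comm]
  refine Finset.sum_congr rfl fun j _ => Finset.sum_congr rfl fun i _ => ?_
  rw [Real.rpow_two, Real.norm_eq_abs, sq_abs, sq]

lemma minner_comm' {n r : ℕ} (X Y : Matrix (Fin n) (Fin r) ℝ) : minner X Y = minner Y X := by
  simp only [minner_eq, mul_comm]

lemma minner_sub_right {n r : ℕ} (X Y Z : Matrix (Fin n) (Fin r) ℝ) :
    minner X (Y - Z) = minner X Y - minner X Z := by
  simp [minner, Matrix.mul_sub]

lemma minner_sub_left {n r : ℕ} (X Y Z : Matrix (Fin n) (Fin r) ℝ) :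
    minner (X - Y) Z = minner X Z - minner Y Z := by
  simp [minner, Matrix.sub_mul]

lemma minner_smul_left {n r : ℕ} (c : ℝ) (X Y : Matrix (Fin n) (Fin r) ℝ) :
    minner (c • X) Y = c * minner X Y := by
  simp [minner]

lemma minner_smul_right {n r : ℕ} (c : ℝ) (X Y : Matrix (Fin n) (Fin r) ℝ) :
    minner X (c • Y) = c * minner X Y := by
  simp [minner]

lemma key {n r : ℕ} (α σ : ℝ) (hα : 0 < α) (hσ : 0 < σ)
    (V : Matrix (Fin n) (Fin r) ℝ) (τ : ℝ) (h : σ ≤ τ)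
    (he : τ ^ 2 * (τ - σ) = α * ‖posPart V‖ ^ 2)
    (W : Matrix (Fin n) (Fin r) ℝ) (hW : ∀ i j, 0 ≤ W i j) :
    hu α σ (τ⁻¹ • posPart V) - minner V (τ⁻¹ • posPart V) + τ / 2 * ‖W - τ⁻¹ • posPart V‖ ^ 2
      ≤ hu α σ W - minner V W := by
  have ht : 0 < τ := by linarith
  have h1 : minner V W ≤ minner (posPart V) W := by
    simp only [minner_eq]
    exact Finset.sum_le_sum fun j _ => Finset.sum_le_sum fun i _ =>
      mul_le_mul_of_nonneg_right (le_max_left _ _) (hW i j)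
  have h2 : minner V (posPart V) = minner (posPart V) (posPart V) := by
    simp only [minner_eq]
    refine Finset.sum_congr rfl fun j _ => Finset.sum_congr rfl fun i _ => ?_
    change V i j * max (V i j) 0 = max (V i j) 0 * max (V i j) 0
    rcases le_total (V i j) 0 with h | h
    · simp [h]
    · simp [h]
  obtain ⟨S, hS⟩ : ∃ S, S = τ⁻¹ • posPart V := ⟨_, rfl⟩
  have hP : posPart V = τ • S := by rw [hS, smul_smul, mul_inv_cancel₀ ht.ne', one_smul]
  rw [← hS]
  rw [hP] at h1 h2 he
  rw [minner_self] at he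
  simp only [minner_smul_left, minner_smul_right] at h1 h2 he
  have h3 : minner V S = τ * minner S S := mul_left_cancel₀ ht.ne' h2
  have h4 : τ - σ = α * minner S S := by
    apply mul_left_cancel₀ (pow_ne_zero 2 ht.ne')
    rw [he]; ring
  have e : ∀ X : Matrix (Fin n) (Fin r) ℝ, ‖X‖ ^ 4 = (‖X‖ ^ 2) ^ 2 := fun X => by ring
  simp only [hu, e, minner_self, minner_sub_left, minner_sub_right, minner_comm' W S]
  rw [h3]
  have h5 := mul_nonneg hα.le (sq_nonneg (minner W W - minner S S))
  have h6 : τ = σ + α * minner S S := by linarith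
  rw [h6] at h1 ⊢
  nlinarith

lemma part1 {n r : ℕ} (α σ : ℝ) (hα : 0 < α) (hσ : 0 < σ)
    (V : Matrix (Fin n) (Fin r) ℝ) (τ : ℝ) (h : σ ≤ τ)
    (he : τ ^ 2 * (τ - σ) = α * ‖posPart V‖ ^ 2) :
      (∀ i j, (0 : ℝ) ≤ (τ⁻¹ • posPart V) i j) ∧
      (∀ W : Matrix (Fin n) (Fin r) ℝ, (∀ i j, 0 ≤ W i j) →
        hu α σ (τ⁻¹ • posPart V) - minner V (τ⁻¹ • posPart V) ≤ hu α σ W - minner V W) ∧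
      (∀ W : Matrix (Fin n) (Fin r) ℝ, (∀ i j, 0 ≤ W i j) →
        hu α σ W - minner V W ≤ hu α σ (τ⁻¹ • posPart V) - minner V (τ⁻¹ • posPart V) →
        W = τ⁻¹ • posPart V) := by
  have ht : 0 < τ := by linarith
  refine ⟨fun i j => ?_, fun W hW => ?_, fun W hW hle => ?_⟩
  · rw [Matrix.smul_apply, smul_eq_mul]
    exact mul_nonneg (inv_nonneg.2 ht.le) (le_max_right _ _)
  · have := key α σ hα hσ V τ h he W hW
    have h0 : 0 ≤ τ / 2 * ‖W - τ⁻¹ • posPart V‖ ^ 2 := by positivity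
    linarith
  · have := key α σ hα hσ V τ h he W hW
    have h0 : τ / 2 * ‖W - τ⁻¹ • posPart V‖ ^ 2 ≤ 0 := by linarith
    have h1 : ‖W - τ⁻¹ • posPart V‖ ^ 2 ≤ 0 := by
      by_contra hc
      push Not at hc
      have := mul_pos (half_pos ht) hc
      linarith
    have h2 : ‖W - τ⁻¹ • posPart V‖ = 0 := pow_eq_zero_iff (two_ne_zero) |>.1
      (le_antisymm h1 (sq_nonneg _))
    exact sub_eq_zero.1 (norm_eq_zero.1 h2)

/-- Bregman iteration map of `h_u` with nonnegativity constraints.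
If `τ ≥ σ` satisfies `τ²(τ − σ) = α‖Π₊(V)‖²`, then `(1/τ)Π₊(V)` is the unique minimizer of
`W ↦ h_u(W) − ⟨V, W⟩` over the nonnegative orthant.  Consequently, when `g` is the indicator
of the nonnegative orthant, `T_λ(X) = Π₊(U) / τ_σ(α‖Π₊(U)‖²)` with `U = ∇h_u(X) − λ∇f(X)`:
`Π₊(U)/τ_σ(α‖Π₊(U)‖²)` is the unique minimizer of `W ↦ ⟨∇f(X), W − X⟩ + (1/λ)D_{h_u}(W, X)`
over the nonnegative orthant. -/
theorem bregman_map_universal_kernel_nonneg {n r : ℕ} (α σ : ℝ)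
    (hα : 0 < α) (hσ : 0 < σ) :
    (∀ (V : Matrix (Fin n) (Fin r) ℝ) (τ : ℝ), σ ≤ τ →
      τ ^ 2 * (τ - σ) = α * ‖posPart V‖ ^ 2 →
      (∀ i j, (0 : ℝ) ≤ (τ⁻¹ • posPart V) i j) ∧
      (∀ W : Matrix (Fin n) (Fin r) ℝ, (∀ i j, 0 ≤ W i j) →
        hu α σ (τ⁻¹ • posPart V) - minner V (τ⁻¹ • posPart V) ≤ hu α σ W - minner V W) ∧
      (∀ W : Matrix (Fin n) (Fin r) ℝ, (∀ i j, 0 ≤ W i j) →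
        hu α σ W - minner V W ≤ hu α σ (τ⁻¹ • posPart V) - minner V (τ⁻¹ • posPart V) →
        W = τ⁻¹ • posPart V)) ∧
    (∀ (X G : Matrix (Fin n) (Fin r) ℝ) (lam τ : ℝ), 0 < lam →
      ∀ U : Matrix (Fin n) (Fin r) ℝ, U = (α * ‖X‖ ^ 2 + σ) • X - lam • G →
      σ ≤ τ → τ ^ 2 * (τ - σ) = α * ‖posPart U‖ ^ 2 →
      (∀ i j, (0 : ℝ) ≤ (τ⁻¹ • posPart U) i j) ∧
      (∀ W : Matrix (Fin n) (Fin r) ℝ, (∀ i j, 0 ≤ W i j) →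
        minner G (τ⁻¹ • posPart U - X) +
          (1 / lam) * (hu α σ (τ⁻¹ • posPart U) - hu α σ X -
            minner ((α * ‖X‖ ^ 2 + σ) • X) (τ⁻¹ • posPart U - X)) ≤
        minner G (W - X) +
          (1 / lam) * (hu α σ W - hu α σ X -
            minner ((α * ‖X‖ ^ 2 + σ) • X) (W - X))) ∧
      (∀ W : Matrix (Fin n) (Fin r) ℝ, (∀ i j, 0 ≤ W i j) →
        minner G (W - X) +
          (1 / lam) * (hu α σ W - hu α σ X -
            minner ((α * ‖X‖ ^ 2 + σ) • X) (W - X)) ≤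
        minner G (τ⁻¹ • posPart U - X) +
          (1 / lam) * (hu α σ (τ⁻¹ • posPart U) - hu α σ X -
            minner ((α * ‖X‖ ^ 2 + σ) • X) (τ⁻¹ • posPart U - X)) →
        W = τ⁻¹ • posPart U)) := by
  refine ⟨fun V τ h he => part1 α σ hα hσ V τ h he, ?_⟩
  intro X G lam τ hl U hU h he
  obtain ⟨p1, p2, p3⟩ := part1 α σ hα hσ U τ h he
  have key2 : ∀ W : Matrix (Fin n) (Fin r) ℝ, minner G (W - X) +
          (1 / lam) * (hu α σ W - hu α σ X - minner ((α * ‖X‖ ^ 2 + σ) • X) (W - X)) =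
          (1 / lam) * (hu α σ W - minner U W) +
          (1 / lam) * (minner U X - hu α σ X) := by
    intro W
    rw [hU]
    simp only [minner_sub_left, minner_sub_right, minner_smul_left]
    field_simp
    ring
  have hl' : 0 < 1 / lam := by positivity
  refine ⟨p1, fun W hW => ?_, fun W hW hle => ?_⟩
  · rw [key2, key2]
    have := mul_le_mul_of_nonneg_left (p2 W hW) hl'.le
    linarith
  · rw [key2, key2] at hle
    exact p3 W hW (le_of_mul_le_mul_left (by linarith) hl')
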